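/- arXiv:1002.0823 — 3 statements merged into one kernel-verified Lean document; each statement's English description precedes it below -/
import Mathlib

section
/- For any K > 0, any positive integer m, and any σ > 0, there exists K̃ > 0 such that: for every complex-valued random variable f on a probability space with |f(ω)| ≤ K almost surely and variance 𝔼(|f|²) − |𝔼(f)|² ≥ σ, there exist z, w ∈ ℂ with |z − w| ≥ (σ/2)^{1/2} such that ℙ(|f − z| ≤ 1/m) ≥ K̃ and ℙ(|f − w| ≤ 1/m) ≥ K̃. The constant K̃ depends only on K, m, and σ, not on f or the probability space. -/
open Filter Metric Set MeasureTheory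

/-- `b : ℤ → ℂ` is a right limit of `a : ℕ → ℂ`. -/
def IsRightLimit (a : ℕ → ℂ) (b : ℤ → ℂ) : Prop :=
  ∃ n : ℕ → ℕ, StrictMono n ∧
    ∀ k : ℤ, Tendsto (fun j => a (k + n j).toNat) atTop (nhds (b k))

/-- `f_+` for a two-sided sequence. -/
noncomputable def fPlus (b : ℤ → ℂ) (z : ℂ) : ℂ := ∑' n : ℕ, b n * z ^ n

/-- `f_-` for a two-sided sequence. -/
noncomputable def fMinus (b : ℤ → ℂ) (z : ℂ) : ℂ :=
  ∑' n : ℕ, b (-(n : ℤ) - 1) * z ^ (-(n : ℤ) - 1)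

/-- The open arc `{e^{iθ} : α < θ < β}` of the unit circle. -/
def arc (α β : ℝ) : Set ℂ := {z | ∃ θ ∈ Set.Ioo α β, z = Complex.exp (θ * Complex.I)}

/-- The two-sided sequence `b` is reflectionless on the arc `I`. -/
def Reflectionless (b : ℤ → ℂ) (I : Set ℂ) : Prop :=
  ∃ g : ℂ → ℂ,
    DifferentiableOn ℂ g ((Metric.sphere (0 : ℂ) 1 \ I)ᶜ) ∧
    (∀ z ∈ Metric.ball (0 : ℂ) 1, g z = fPlus b z) ∧
    (∀ z : ℂ, 1 < ‖z‖ → g z = - fMinus b z)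

/-- `f` has a strong natural boundary on the unit circle. -/
def StrongNaturalBoundary (f : ℂ → ℂ) : Prop :=
  ∀ α β : ℝ, α < β →
    ¬ ∃ M : ℝ, ∀ r : ℝ, 0 < r → r < 1 →
      (∫ θ in α..β, ‖f (r * Complex.exp (θ * Complex.I))‖) / (2 * Real.pi) ≤ M

/-- `f` has a (classical) natural boundary on the unit circle. -/
def NaturalBoundary (f : ℂ → ℂ) : Prop :=
  ¬ ∃ z₀ : ℂ, ‖z₀‖ = 1 ∧ ∃ δ > (0 : ℝ), ∃ g : ℂ → ℂ,
    DifferentiableOn ℂ g (Metric.ball (0 : ℂ) 1 ∪ Metric.ball z₀ δ) ∧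
    ∀ z ∈ Metric.ball (0 : ℂ) 1, g z = f z

theorem stmt17 (K : ℝ) (hK : 0 < K) (m : ℕ) (hm : 0 < m) (σ : ℝ) (hσ : 0 < σ) :
    ∃ Kt : ℝ, 0 < Kt ∧
      ∀ (Ω : Type) (_ : MeasurableSpace Ω) (μ : MeasureTheory.Measure Ω),
        MeasureTheory.IsProbabilityMeasure μ →
        ∀ f : Ω → ℂ, Measurable f →
          (∀ᵐ ω ∂μ, ‖f ω‖ ≤ K) →
          σ ≤ (∫ ω, ‖f ω‖ ^ 2 ∂μ) - ‖∫ ω, f ω ∂μ‖ ^ 2 →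
          ∃ z w : ℂ, Real.sqrt (σ / 2) ≤ ‖z - w‖ ∧
            ENNReal.ofReal Kt ≤ μ {ω | ‖f ω - z‖ ≤ 1 / m} ∧
            ENNReal.ofReal Kt ≤ μ {ω | ‖f ω - w‖ ≤ 1 / m} := by
  set d := Real.sqrt (σ / 2) with hd
  have hdpos : 0 < d := Real.sqrt_pos.mpr (by linarith)
  have hd2 : d ^ 2 = σ / 2 := Real.sq_sqrt (by linarith)
  have hm' : (0 : ℝ) < 1 / m := by positivity
  set r := min (1 / (m : ℝ)) (d / 8) with hr
  have hrpos : 0 < r := lt_min hm' (by linarith)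
  obtain ⟨t, htK, htf, htc⟩ :=
    (isCompact_closedBall (0 : ℂ) K).finite_cover_balls hrpos
  lift t to Finset ℂ using htf
  set c := σ / (16 * K ^ 2) / (t.card + 1) with hc
  have hcpos : 0 < c := by positivity
  refine ⟨c, hcpos, ?_⟩
  intro Ω _ μ _ f hf hfK hvar
  by_contra hcon
  push Not at hcon
  classical
  let S : ℂ → Set Ω := fun x => {ω | ‖f ω - x‖ ≤ 1 / m}
  have hS : ∀ x, MeasurableSet (S x) := fun x =>
    measurableSet_le (by fun_prop) (by fun_prop)
  let B : Set Ω := ⋃ x ∈ t.filter (fun x => μ.real (S x) < c), S x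
  have hB : MeasurableSet B := Finset.measurableSet_biUnion _ fun x _ => hS x
  have hBm : μ.real B ≤ t.card * c := by
    calc μ.real B ≤ ∑ x ∈ t.filter (fun x => μ.real (S x) < c), μ.real (S x) :=
          measureReal_biUnion_finset_le _ _
      _ ≤ ∑ x ∈ t.filter (fun x => μ.real (S x) < c), c :=
          Finset.sum_le_sum fun x hx => (Finset.mem_filter.mp hx).2.le
      _ = (t.filter (fun x => μ.real (S x) < c)).card * c := by simp
      _ ≤ t.card * c := by
          gcongr
          exact Finset.filter_subset _ _
  have hgood : ∀ x, c ≤ μ.real (S x) → ENNReal.ofReal c ≤ μ (S x) := fun x hx =>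
    ENNReal.ofReal_le_of_le_toReal hx
  have hpair : ∀ x y, c ≤ μ.real (S x) → c ≤ μ.real (S y) → ‖x - y‖ ≤ d := by
    intro x y hx hy
    by_contra h
    push Not at h
    exact absurd (hgood y hy) (not_le.mpr (hcon x y h.le (hgood x hx)))
  obtain ⟨x0, hx0K, hx0⟩ : ∃ x0 : ℂ, ‖x0‖ ≤ K ∧
      ∀ x ∈ t, c ≤ μ.real (S x) → ‖x - x0‖ ≤ d := by
    by_cases h : ∃ y ∈ t, c ≤ μ.real (S y)
    · obtain ⟨y, hy, hyc⟩ := h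
      exact ⟨y, by simpa using htK hy, fun x _ hx => hpair x y hx hyc⟩
    · push Not at h
      exact ⟨0, by simpa using hK.le, fun x hx hxc => absurd hxc (not_le.mpr (h x hx))⟩
  have hpt : ∀ᵐ ω ∂μ, ‖f ω - x0‖ ^ 2 ≤
      (d + d / 8) ^ 2 + B.indicator (fun _ => (2 * K) ^ 2) ω := by
    filter_upwards [hfK] with ω hω
    have hmem : f ω ∈ closedBall (0 : ℂ) K := by simpa using hω
    obtain ⟨x, hx, hxb⟩ := mem_iUnion₂.mp (htc hmem)
    have hxb' : ‖f ω - x‖ < r := by simpa [dist_eq_norm] using hxb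
    by_cases hxc : c ≤ μ.real (S x)
    · have h1 : ‖f ω - x0‖ ≤ d + d / 8 := by
        have := norm_sub_le_norm_sub_add_norm_sub (f ω) x x0
        have h2 := hx0 x hx hxc
        have h3 : r ≤ d / 8 := min_le_right _ _
        linarith
      have h2 : 0 ≤ B.indicator (fun _ => (2 * K) ^ 2) ω :=
        indicator_nonneg (fun _ _ => by positivity) _
      have : ‖f ω - x0‖ ^ 2 ≤ (d + d / 8) ^ 2 := by gcongr
      linarith
    · have hωB : ω ∈ B := by
        refine mem_iUnion₂.mpr ⟨x, Finset.mem_filter.mpr ⟨hx, not_le.mp hxc⟩, ?_⟩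
        exact hxb'.le.trans (min_le_left _ _)
      rw [indicator_of_mem hωB]
      have h1 : ‖f ω - x0‖ ≤ 2 * K := by
        have := norm_sub_le (f ω) x0
        linarith
      have : ‖f ω - x0‖ ^ 2 ≤ (2 * K) ^ 2 := by gcongr
      nlinarith
  have hfi : Integrable f μ :=
    Integrable.of_bound hf.aestronglyMeasurable K hfK
  have hf2 : Integrable (fun ω => ‖f ω‖ ^ 2) μ := by
    refine Integrable.of_bound (by fun_prop) (K ^ 2) ?_
    filter_upwards [hfK] with ω hω
    rw [Real.norm_of_nonneg (by positivity)]
    gcongr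
  have hexp : ∀ ω, ‖f ω - x0‖ ^ 2 = ‖f ω‖ ^ 2 - 2 * inner ℝ x0 (f ω) + ‖x0‖ ^ 2 := by
    intro ω
    rw [norm_sub_sq_real, real_inner_comm]
  have hin : Integrable (fun ω => inner ℝ x0 (f ω)) μ := hfi.const_inner x0
  have hg : Integrable (fun ω => ‖f ω - x0‖ ^ 2) μ := by
    simp_rw [hexp]
    exact (hf2.sub (hin.const_mul 2)).add (integrable_const _)
  have hI : ∫ ω, ‖f ω - x0‖ ^ 2 ∂μ =
      ∫ ω, ‖f ω‖ ^ 2 ∂μ - 2 * inner ℝ x0 (∫ ω, f ω ∂μ) + ‖x0‖ ^ 2 := by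
    have hsub : Integrable (fun ω => ‖f ω‖ ^ 2 - 2 * inner ℝ x0 (f ω)) μ :=
      hf2.sub (hin.const_mul 2)
    simp_rw [hexp]
    rw [integral_add hsub (integrable_const _),
      integral_sub hf2 (hin.const_mul 2), integral_const_mul, integral_inner hfi]
    simp
  have hsq : 0 ≤ ‖(∫ ω, f ω ∂μ) - x0‖ ^ 2 := by positivity
  rw [norm_sub_sq_real, real_inner_comm] at hsq
  have hind : Integrable (B.indicator (fun _ => (2 * K) ^ 2)) μ :=
    (integrable_const _).indicator hB
  have hub : ∫ ω, ‖f ω - x0‖ ^ 2 ∂μ ≤ (d + d / 8) ^ 2 + μ.real B * (2 * K) ^ 2 := by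
    calc _ ≤ ∫ ω, ((d + d / 8) ^ 2 + B.indicator (fun _ => (2 * K) ^ 2) ω) ∂μ :=
          integral_mono_ae hg ((integrable_const _).add hind) hpt
      _ = _ := by
          rw [integral_add (integrable_const _) hind, integral_indicator_const _ hB]
          simp
  have hBK : μ.real B * (2 * K) ^ 2 ≤ σ / 4 := by
    have h1 : (t.card : ℝ) * c ≤ σ / (16 * K ^ 2) := by
      have : (t.card + 1 : ℝ) * c = σ / (16 * K ^ 2) := by
        rw [hc]; field_simp
      linarith
    calc μ.real B * (2 * K) ^ 2 ≤ σ / (16 * K ^ 2) * (2 * K) ^ 2 := by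
          gcongr; exact hBm.trans h1
      _ = σ / 4 := by field_simp; norm_num
  nlinarith
end

section
/- Let A > 0 and let μ be a probability measure on the space of two-sided complex sequences { (a_n)_{n∈ℤ} : sup_n |a_n| ≤ A } that is invariant and ergodic under the left shift. Then a two-sided sequence b : ℤ → ℂ lies in the support of μ if and only if the set of sequences (a_n)_{n∈ℤ} for which b is a right limit of the one-sided sequence (a_n)_{n≥0} has positive μ-measure; moreover, in that case b is a right limit of (a_n)_{n≥0} for μ-almost every sequence. -/
open Filter Metric Set MeasureTheory

/-- The left shift on two-sided sequences. -/
def leftShift (a : ℤ → ℂ) : ℤ → ℂ := fun n => a (n + 1)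

lemma leftShift_iterate (n : ℕ) (a : ℤ → ℂ) (k : ℤ) : leftShift^[n] a k = a (k + n) := by
  induction n generalizing a with
  | zero => simp
  | succ m ih =>
    rw [Function.iterate_succ_apply, ih]
    simp only [leftShift]
    congr 1
    push_cast
    ring

lemma isRightLimit_iff (a b : ℤ → ℂ) :
    IsRightLimit (fun n : ℕ => a (n : ℤ)) b ↔
      MapClusterPt b atTop (fun n : ℕ => leftShift^[n] a) := by
  have key : ∀ n : ℕ → ℕ, StrictMono n →
      ((∀ k : ℤ, Tendsto (fun j => a (((k + n j).toNat : ℕ) : ℤ)) atTop (nhds (b k))) ↔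
        Tendsto (fun j => leftShift^[n j] a) atTop (nhds b)) := by
    intro n hn
    rw [tendsto_pi_nhds]
    refine forall_congr' fun k => tendsto_congr' ?_
    filter_upwards [hn.tendsto_atTop.eventually_ge_atTop (-k).toNat] with j hj
    rw [leftShift_iterate]
    congr 1
    omega
  constructor
  · rintro ⟨n, hn, h⟩
    exact ((key n hn).1 h).mapClusterPt.of_comp hn.tendsto_atTop
  · intro h
    obtain ⟨n, hn, h⟩ := MapClusterPt.tendsto_subseq h
    exact ⟨n, hn, (key n hn).2 h⟩

lemma ae_frequently_of_pos (μ : Measure (ℤ → ℂ)) [IsProbabilityMeasure μ]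
    (herg : Ergodic leftShift μ) (U : Set (ℤ → ℂ)) (hU : MeasurableSet U) (hpos : 0 < μ U) :
    ∀ᵐ a ∂μ, ∃ᶠ n in atTop, leftShift^[n] a ∈ U := by
  have hmeas : MeasurableSet {a | ∃ᶠ n in atTop, leftShift^[n] a ∈ U} := by
    have : {a | ∃ᶠ n in atTop, leftShift^[n] a ∈ U} =
        ⋂ m : ℕ, ⋃ n : ℕ, ⋃ _ : m ≤ n, (leftShift^[n]) ⁻¹' U := by
      ext a
      simp [frequently_atTop]
    rw [this]
    exact MeasurableSet.iInter fun m => MeasurableSet.iUnion fun n => MeasurableSet.iUnion fun _ =>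
      (herg.measurable.iterate n) hU
  have hinv : leftShift ⁻¹' {a | ∃ᶠ n in atTop, leftShift^[n] a ∈ U} =
      {a | ∃ᶠ n in atTop, leftShift^[n] a ∈ U} := by
    ext a
    simp only [mem_preimage, mem_ofPred_eq, ← Function.iterate_succ_apply]
    conv_rhs => rw [← map_add_atTop_eq_nat 1, frequently_map]
  rcases herg.toPreErgodic.ae_mem_or_ae_notMem hmeas hinv with h | h
  · exact h
  · exfalso
    have h2 := herg.toMeasurePreserving.conservative.ae_mem_imp_frequently_image_mem
      hU.nullMeasurableSet
    refine hpos.ne' (measure_eq_zero_iff_ae_notMem.2 ?_)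
    filter_upwards [h, h2] with a h h2 ha
    exact h (h2 ha)

theorem stmt18 (A : ℝ) (hA : 0 < A)
    (μ : Measure (ℤ → ℂ)) [IsProbabilityMeasure μ]
    (hbd : μ {a : ℤ → ℂ | ∀ n : ℤ, ‖a n‖ ≤ A} = 1)
    (herg : Ergodic leftShift μ)
    (b : ℤ → ℂ) :
    ((∀ U : Set (ℤ → ℂ), IsOpen U → b ∈ U → 0 < μ U) ↔
      0 < μ {a : ℤ → ℂ | IsRightLimit (fun n : ℕ => a (n : ℤ)) b}) ∧
    ((∀ U : Set (ℤ → ℂ), IsOpen U → b ∈ U → 0 < μ U) →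
      ∀ᵐ a ∂μ, IsRightLimit (fun n : ℕ => a (n : ℤ)) b) := by
  simp only [isRightLimit_iff]
  have fwd : (∀ U : Set (ℤ → ℂ), IsOpen U → b ∈ U → 0 < μ U) →
      ∀ᵐ a ∂μ, MapClusterPt b atTop (fun n : ℕ => leftShift^[n] a) := by
    intro h
    obtain ⟨V, hV⟩ := (nhds b).exists_antitone_basis
    have h1 : ∀ i, ∀ᵐ a ∂μ, ∃ᶠ n in atTop, leftShift^[n] a ∈ interior (V i) := fun i =>
      ae_frequently_of_pos μ herg _ isOpen_interior.measurableSet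
        (h _ isOpen_interior (mem_interior_iff_mem_nhds.2 (hV.mem i)))
    filter_upwards [ae_all_iff.2 h1] with a ha
    rw [hV.1.mapClusterPt_iff_frequently]
    exact fun i _ => (ha i).mono fun n hn => interior_subset hn
  refine ⟨⟨fun h => ?_, fun h U hU hb => ?_⟩, fwd⟩
  · have : μ {a | MapClusterPt b atTop (fun n : ℕ => leftShift^[n] a)} = 1 := by
      rw [← measure_univ (μ := μ)]
      exact measure_congr (eventuallyEq_univ.2 (fwd h))
    rw [this]
    exact zero_lt_one
  · by_contra h0
    have h0 : μ U = 0 := by simpa using h0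
    refine h.ne' (measure_mono_null (t := ⋃ n : ℕ, (leftShift^[n]) ⁻¹' U) ?_ ?_)
    · intro a ha
      obtain ⟨n, hn⟩ := (MapClusterPt.frequently ha (hU.mem_nhds hb)).exists
      exact mem_iUnion.2 ⟨n, hn⟩
    · refine measure_iUnion_null fun n => ?_
      rw [(herg.toMeasurePreserving.iterate n).measure_preimage hU.measurableSet.nullMeasurableSet, h0]
end

section
/- Let T : ∂𝔻 → ∂𝔻 be a homeomorphism of the unit circle such that for every e^{iθ} ∈ ∂𝔻 the forward orbit {T^k(e^{iθ}) : k = 0, 1, 2, …} is dense in ∂𝔻. Let f : ∂𝔻 → ℂ be a bounded function continuous except at finitely many points, such that at at least one discontinuity point the two one-sided limits of f along the circle exist and are unequal. Then for every e^{iθ} ∈ ∂𝔻, the power series Σ_{n=0}^∞ f(T^n(e^{iθ})) z^n defines an analytic function on the open unit disc 𝔻 with a strong natural boundary on ∂𝔻. -/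
open Filter Metric Set MeasureTheory

lemma vdc {V : Type*} [SeminormedAddCommGroup V] [InnerProductSpace ℂ V] (x : ℕ → V) (G η δ : ℝ)
    (hx : ∀ n, ‖x n‖ ≤ G) (hη : 0 ≤ η) (N₀ : ℕ)
    (hc : ∀ m n, m + N₀ ≤ n → ‖inner ℂ (x m) (x n)‖ ≤ η) (v : V) (hδ : 0 < δ)
    (hf : ∃ᶠ n in atTop, δ ≤ ‖inner ℂ (x n) v‖) : δ ^ 4 ≤ ‖v‖ ^ 4 * G ^ 2 * η := by
  obtain ⟨φ, hφ, hp⟩ := extraction_of_frequently_atTop hf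
  have hG : 0 ≤ G := (norm_nonneg _).trans (hx 0)
  have hgap : ∀ i j : ℕ, i < j → φ (N₀ * i) + N₀ ≤ φ (N₀ * j) := by
    intro i j hij
    have h1 : φ (N₀ * i) + N₀ ≤ φ (N₀ * i + N₀) := by
      clear hij
      generalize N₀ * i = a
      have : ∀ b, φ a + b ≤ φ (a + b) := by
        intro b
        induction b with
        | zero => simp
        | succ b ih =>
          have := hφ (show a + b < a + (b+1) by omega)
          omega
      exact this N₀
    refine h1.trans (hφ.monotone ?_)
    nlinarith
  set y : ℕ → V := fun i => x (φ (N₀ * i)) with hy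
  have hyn : ∀ i, ‖y i‖ ≤ G := fun i => hx _
  have hyc : ∀ i j, i ≠ j → ‖inner ℂ (y i) (y j)‖ ≤ η := by
    intro i j hij
    rcases lt_or_gt_of_ne hij with h | h
    · exact hc _ _ (hgap _ _ h)
    · rw [norm_inner_symm]; exact hc _ _ (hgap _ _ h)
  have hyd : ∀ i, δ ≤ ‖inner ℂ (y i) v‖ := fun i => hp _
  set A := G * ‖v‖ with hA
  have hA0 : 0 ≤ A := by positivity
  have hyA : ∀ i, ‖inner ℂ (y i) v‖ ≤ A := fun i => (norm_inner_le_norm _ _).trans (mul_le_mul_of_nonneg_right (hyn i) (norm_nonneg _))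
  -- main bound
  have key : ∀ J : ℕ, (J * δ ^ 2) ^ 2 ≤ ‖v‖ ^ 2 * (A ^ 2 * (J * G ^ 2 + J ^ 2 * η)) := by
    intro J
    set s : V := ∑ i ∈ Finset.range J, (inner ℂ (y i) v) • y i with hs
    have h1 : (J * δ ^ 2) ≤ ‖inner ℂ s v‖ := by
      have : inner ℂ s v = ((∑ i ∈ Finset.range J, ‖inner ℂ (y i) v‖ ^ 2 : ℝ) : ℂ) := by
        rw [hs, sum_inner]
        push_cast
        refine Finset.sum_congr rfl fun i _ => ?_
        rw [inner_smul_left]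
        exact Complex.conj_mul' _
      rw [this, Complex.norm_real]
      refine le_trans ?_ (le_abs_self _)
      calc (J * δ ^ 2) = ∑ i ∈ Finset.range J, δ ^ 2 := by simp
        _ ≤ _ := by gcongr; exact hyd _
    have h2 : ‖s‖ ^ 2 ≤ A ^ 2 * (J * G ^ 2 + J ^ 2 * η) := by
      have h3 : ‖s‖ ^ 2 ≤ ∑ i ∈ Finset.range J, ∑ j ∈ Finset.range J, A ^ 2 * ((if i = j then G ^ 2 else 0) + η) := by
        have : ‖s‖ ^ 2 = ‖inner ℂ s s‖ := by
          rw [inner_self_eq_norm_sq_to_K]; simp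
        rw [this]
        nth_rewrite 1 [hs]
        rw [hs, sum_inner]
        refine (norm_sum_le _ _).trans (Finset.sum_le_sum fun i _ => ?_)
        rw [inner_sum]
        refine (norm_sum_le _ _).trans (Finset.sum_le_sum fun j _ => ?_)
        rw [inner_smul_left, inner_smul_right, ← mul_assoc, norm_mul, norm_mul, RCLike.norm_conj, sq A]
        gcongr
        · exact hyA i
        · exact hyA j
        · split_ifs with h
          · subst h
            refine (norm_inner_le_norm _ _).trans ?_
            have := hyn i
            nlinarith [norm_nonneg (y i)]
          · simpa using hyc i j h
      refine h3.trans (le_of_eq ?_)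
      simp only [← Finset.mul_sum, Finset.sum_add_distrib]
      have e1 : ∑ i ∈ Finset.range J, ∑ j ∈ Finset.range J, (if i = j then G ^ 2 else 0) = J * G ^ 2 := by
        rw [Finset.sum_congr rfl (g := fun _ => G ^ 2)]
        · simp
        · intro i hi
          rw [Finset.sum_ite_eq, if_pos hi]
      rw [e1]
      simp
      ring_nf
      simp
    calc (J * δ ^ 2) ^ 2 ≤ (‖s‖ * ‖v‖) ^ 2 := by
          exact pow_le_pow_left₀ (by positivity) (h1.trans (norm_inner_le_norm _ _)) 2
      _ = ‖v‖ ^ 2 * ‖s‖ ^ 2 := by ring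
      _ ≤ _ := by gcongr
  have key2 : ∀ J : ℕ, 0 < J → δ ^ 4 ≤ ‖v‖ ^ 2 * A ^ 2 * η + (‖v‖ ^ 2 * A ^ 2 * G ^ 2) * (1 / J) := by
    intro J hJ
    have hJ' : (0 : ℝ) < J := by exact_mod_cast hJ
    have := key J
    rw [← mul_le_mul_iff_right₀ (show (0:ℝ) < J ^ 2 by positivity)]
    calc (J:ℝ) ^ 2 * δ ^ 4 = (J * δ ^ 2) ^ 2 := by ring
      _ ≤ _ := this
      _ = _ := by field_simp; ring
  have lim : Tendsto (fun J : ℕ => ‖v‖ ^ 2 * A ^ 2 * η + (‖v‖ ^ 2 * A ^ 2 * G ^ 2) * (1 / (J:ℝ))) atTop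
      (nhds (‖v‖ ^ 2 * A ^ 2 * η + (‖v‖ ^ 2 * A ^ 2 * G ^ 2) * 0)) :=
    (tendsto_one_div_atTop_nhds_zero_nat.const_mul _).const_add _
  have := ge_of_tendsto lim (eventually_gt_atTop 0 |>.mono fun J hJ => key2 J hJ)
  refine this.trans (le_of_eq ?_)
  rw [hA]; ring

lemma approx_riesz {V : Type*} [SeminormedAddCommGroup V] [InnerProductSpace ℂ V] (Λ : V →L[ℂ] ℂ)
    {ε : ℝ} (hε : 0 < ε) : ∃ g : V, ∀ x, ‖Λ x - inner ℂ g x‖ ≤ ε * ‖x‖ := by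
  let e : V →L[ℂ] UniformSpace.Completion V := UniformSpace.Completion.toComplL
  let Λ' : UniformSpace.Completion V →L[ℂ] ℂ := Λ.extend e
  have hΛ' : ∀ x : V, Λ' x = Λ x := by
    intro x
    exact ContinuousLinearMap.extend_eq Λ UniformSpace.Completion.denseRange_coe
      (UniformSpace.Completion.isUniformInducing_coe V) x
  let g₀ := (InnerProductSpace.toDual ℂ (UniformSpace.Completion V)).symm Λ'
  obtain ⟨g, hg⟩ := UniformSpace.Completion.denseRange_coe.exists_dist_lt g₀ hε
  refine ⟨g, fun x => ?_⟩
  have e1 : inner ℂ g₀ (x : UniformSpace.Completion V) = Λ x := by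
    rw [← hΛ']; exact InnerProductSpace.toDual_symm_apply
  rw [← e1, ← UniformSpace.Completion.inner_coe g x, ← inner_sub_left]
  refine (norm_inner_le_norm _ _).trans ?_
  rw [UniformSpace.Completion.norm_coe]
  gcongr
  rw [dist_eq_norm] at hg
  exact hg.le

lemma weak_sym {V : Type*} [SeminormedAddCommGroup V] [InnerProductSpace ℂ V] (U : ℤ → V → V)
    (hU : ∀ n x y, inner ℂ (U n x) (U n y) = inner ℂ x y) (hU2 : ∀ m n x, U m (U n x) = U (m + n) x)
    (hU0 : ∀ x, U 0 x = x)
    (Λ : V →L[ℂ] ℂ) (hΛ : ∀ x, Tendsto (fun n : ℕ => Λ (U n x)) atTop (nhds 0)) (v : V) :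
    Tendsto (fun n : ℕ => Λ (U (-n) v)) atTop (nhds 0) := by
  by_contra hcon
  obtain ⟨δ, hδ, hf⟩ : ∃ δ > 0, ∃ᶠ n : ℕ in atTop, δ ≤ ‖Λ (U (-n) v)‖ := by
    rw [Metric.tendsto_nhds] at hcon
    push Not at hcon
    simpa using hcon
  have hUn : ∀ n x, ‖U n x‖ = ‖x‖ := by
    intro n x
    rw [@norm_eq_sqrt_re_inner ℂ, @norm_eq_sqrt_re_inner ℂ, hU]
  set G := ‖Λ‖ + 1 with hG
  have hG0 : 0 < G := by positivity
  -- for all small ε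
  have main : ∀ ε : ℝ, 0 < ε → ε ≤ 1 → ε * ‖v‖ ≤ δ / 2 → (δ / 2) ^ 4 ≤ ‖v‖ ^ 4 * G ^ 2 * (ε * (G + 1)) := by
    intro ε hε hε1 hεv
    obtain ⟨g, hg⟩ := approx_riesz Λ hε
    have hgG : ‖g‖ ≤ G := by
      by_contra! h
      have hg0 : 0 < ‖g‖ := hG0.trans h
      have h1 : ‖g‖ ^ 2 = ‖inner ℂ g g‖ := by rw [inner_self_eq_norm_sq_to_K]; simp
      have h2 : ‖inner ℂ g g‖ ≤ ‖Λ g‖ + ‖Λ g - inner ℂ g g‖ := by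
        rw [norm_sub_rev]; simpa using norm_add_le (Λ g) (inner ℂ g g - Λ g)
      have h3 := Λ.le_opNorm g
      have h4 := hg g
      nlinarith
    obtain ⟨N₀, hN₀⟩ : ∃ N₀ : ℕ, ∀ n : ℕ, N₀ ≤ n → ‖Λ (U n g)‖ ≤ ε := by
      have := (Metric.tendsto_nhds.1 (hΛ g)) ε hε
      obtain ⟨N₀, h⟩ := eventually_atTop.1 this
      exact ⟨N₀, fun n hn => by simpa using (h n hn).le⟩
    refine vdc (fun n : ℕ => U n g) G _ (δ / 2) (fun n => by rw [hUn]; exact hgG) (by positivity) N₀ ?_ v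
      (by positivity) ?_
    · intro m n hmn
      have e1 : inner ℂ (U m g) (U n g) = inner ℂ g (U ((n - m : ℕ)) g) := by
        rw [← hU (m : ℤ) g, hU2]; congr 2; omega
      rw [e1]
      have h2 : ‖inner ℂ g (U ((n - m : ℕ)) g)‖ ≤ ‖Λ (U ((n - m : ℕ)) g)‖ + ‖Λ (U ((n - m : ℕ)) g) - inner ℂ g (U ((n - m : ℕ)) g)‖ := by
        rw [norm_sub_rev]; simpa using norm_add_le (Λ (U ((n - m : ℕ)) g)) (inner ℂ g (U ((n - m : ℕ)) g) - Λ (U ((n - m : ℕ)) g))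
      have h3 := hN₀ (n - m) (by omega)
      have h4 := hg (U ((n - m : ℕ)) g)
      rw [hUn] at h4
      nlinarith
    · refine hf.mono fun n hn => ?_
      have e1 : inner ℂ (U n g) v = inner ℂ g (U (-n) v) := by
        rw [← hU (n : ℤ) g, hU2]; simp [hU0]
      rw [e1]
      have h4 := hg (U (-n) v)
      rw [hUn] at h4
      have := norm_sub_norm_le (Λ (U (-n) v)) (inner ℂ g (U (-n) v))
      linarith
  have lim : ∀ c : ℝ, Tendsto (fun ε : ℝ => ε * c) (nhdsWithin 0 (Ioi 0)) (nhds 0) := by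
    intro c
    have : Tendsto (fun ε : ℝ => ε * c) (nhds 0) (nhds (0 * c)) := tendsto_id.mul_const c
    rw [zero_mul] at this
    exact this.mono_left nhdsWithin_le_nhds
  have hev : ∀ᶠ ε : ℝ in nhdsWithin 0 (Ioi 0), (δ / 2) ^ 4 ≤ ε * (‖v‖ ^ 4 * G ^ 2 * (G + 1)) := by
    filter_upwards [self_mem_nhdsWithin, (lim 1).eventually (eventually_le_nhds one_pos),
      (lim ‖v‖).eventually (eventually_le_nhds (show 0 < δ / 2 by positivity))] with ε h1 h2 h3
    refine (main ε h1 (by simpa using h2) h3).trans (le_of_eq (by ring))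
  have := ge_of_tendsto (lim _) hev
  have : 0 < (δ / 2) ^ 4 := by positivity
  linarith

lemma weak_sym' {V : Type*} [AddCommGroup V] [Module ℂ V] (c : PreInnerProductSpace.Core ℂ V) (U : ℤ → V → V)
    (hU : ∀ n x y, c.inner (U n x) (U n y) = c.inner x y) (hU2 : ∀ m n x, U m (U n x) = U (m + n) x)
    (hU0 : ∀ x, U 0 x = x) (Λ : V →ₗ[ℂ] ℂ) (K : ℝ) (hK0 : 0 ≤ K)
    (hK : ∀ x, ‖Λ x‖ ^ 2 ≤ K * (c.inner x x).re)
    (hΛ : ∀ x, Tendsto (fun n : ℕ => Λ (U n x)) atTop (nhds 0)) (v : V) :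
    Tendsto (fun n : ℕ => Λ (U (-n) v)) atTop (nhds 0) := by
  let _ : SeminormedAddCommGroup V := @InnerProductSpace.Core.toSeminormedAddCommGroup ℂ V _ _ _ c
  let _ : InnerProductSpace ℂ V := InnerProductSpace.ofCore c
  have hn : ∀ x : V, (c.inner x x).re = ‖x‖ ^ 2 := fun x => (norm_sq_eq_re_inner (𝕜 := ℂ) x).symm
  let Λ' : V →L[ℂ] ℂ := Λ.mkContinuous (Real.sqrt K) (by
    intro x
    refine abs_le_of_sq_le_sq' ?_ (by positivity) |>.2
    rw [mul_pow, Real.sq_sqrt hK0, ← hn]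
    exact hK x)
  exact weak_sym U hU hU2 hU0 Λ' hΛ v

/-- The exponential monomials. -/
noncomputable def EE (n : ℤ) (θ : ℝ) : ℂ := Complex.exp (n * θ * Complex.I)

lemma EE_add (m n : ℤ) (θ : ℝ) : EE (m + n) θ = EE m θ * EE n θ := by
  simp only [EE, ← Complex.exp_add]; congr 1; push_cast; ring

lemma EE_zero (θ : ℝ) : EE 0 θ = 1 := by simp [EE]

lemma EE_norm (n : ℤ) (θ : ℝ) : ‖EE n θ‖ = 1 := by
  have : EE n θ = Complex.exp (((n * θ : ℝ) : ℂ) * Complex.I) := by simp [EE]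
  rw [this, Complex.norm_exp_ofReal_mul_I]

lemma EE_cont (n : ℤ) : Continuous (EE n) := by unfold EE; fun_prop

lemma EE_conj (n : ℤ) (θ : ℝ) : starRingEnd ℂ (EE n θ) = EE (-n) θ := by
  simp [EE, ← Complex.exp_conj]

lemma ultra_lim (U : Ultrafilter ℕ) (u : ℕ → ℂ) (R : ℝ) (hu : ∀ j, ‖u j‖ ≤ R) :
    ∃ L, Tendsto u U (nhds L) := by
  obtain ⟨L, -, hL⟩ := (isCompact_closedBall (0 : ℂ) R).ultrafilter_le_nhds (U.map u) (by
    simp only [Ultrafilter.coe_map, le_principal_iff, Filter.mem_map]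
    exact univ_mem' (fun j => by simpa using hu j))
  exact ⟨L, hL⟩

/-- Trigonometric polynomials. -/
def TP : Submodule ℂ (ℝ → ℂ) := Submodule.span ℂ (Set.range EE)

lemma TP_prop (x : ℝ → ℂ) (hx : x ∈ TP) : Continuous x ∧ ∃ K : ℝ, 0 ≤ K ∧ ∀ θ, ‖x θ‖ ≤ K := by
  induction hx using Submodule.span_induction with
  | mem x h => obtain ⟨n, rfl⟩ := h; exact ⟨EE_cont n, 1, by simp, fun θ => (EE_norm n θ).le⟩
  | zero => exact ⟨continuous_zero, 0, le_rfl, by simp⟩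
  | add x y _ _ h1 h2 =>
    obtain ⟨c1, K1, p1, b1⟩ := h1
    obtain ⟨c2, K2, p2, b2⟩ := h2
    exact ⟨c1.add c2, K1 + K2, by positivity, fun θ => (norm_add_le _ _).trans (add_le_add (b1 θ) (b2 θ))⟩
  | smul a x _ h1 =>
    obtain ⟨c1, K1, p1, b1⟩ := h1
    exact ⟨c1.const_smul a, ‖a‖ * K1, by positivity, fun θ => by
      simp only [Pi.smul_apply, smul_eq_mul, norm_mul]; gcongr; exact b1 θ⟩

lemma TP_mul (n : ℤ) (x : ℝ → ℂ) (hx : x ∈ TP) : EE n * x ∈ TP := by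
  induction hx using Submodule.span_induction with
  | mem x h =>
    obtain ⟨m, rfl⟩ := h
    exact Submodule.subset_span ⟨n + m, by ext θ; exact EE_add n m θ⟩
  | zero => rw [mul_zero]; exact TP.zero_mem
  | add x y _ _ h1 h2 => rw [mul_add]; exact TP.add_mem h1 h2
  | smul a x _ h1 => rw [mul_smul_comm]; exact TP.smul_mem _ h1

lemma TP_int (x : ℝ → ℂ) (hx : Continuous x) {K : ℝ} (hK : ∀ θ, ‖x θ‖ ≤ K) {μ : Measure ℝ} {G : ℝ → ℂ}
    (hG : Integrable G μ) : Integrable (fun θ => x θ * G θ) μ := by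
  refine hG.bdd_mul (c := K) hx.aestronglyMeasurable (Eventually.of_forall hK)

lemma TP_le (x : ℝ → ℂ) (hx : Continuous x) {K M : ℝ} (hK0 : 0 ≤ K) (hK : ∀ θ, ‖x θ‖ ≤ K) {μ : Measure ℝ} {G : ℝ → ℂ}
    (hG : Integrable G μ) (hM : ∫ θ, ‖G θ‖ ∂μ ≤ M) : ‖∫ θ, x θ * G θ ∂μ‖ ≤ K * M := by
  refine (norm_integral_le_integral_norm _).trans ?_
  calc _ ≤ ∫ θ, K * ‖G θ‖ ∂μ := by
        refine integral_mono (TP_int x hx hK hG).norm (hG.norm.const_mul K) fun θ => ?_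
        simp only [norm_mul]
        exact mul_le_mul_of_nonneg_right (hK θ) (norm_nonneg _)
    _ = K * ∫ θ, ‖G θ‖ ∂μ := integral_const_mul _ _
    _ ≤ _ := by gcongr

theorem rajchman (μ : Measure ℝ) (G : ℕ → ℝ → ℂ) (M : ℝ) (hM0 : 0 < M) (hG : ∀ j, Integrable (G j) μ)
    (hM : ∀ j, ∫ θ, ‖G j θ‖ ∂μ ≤ M) (S : ℤ → ℂ)
    (hS : ∀ n, Tendsto (fun j => ∫ θ, EE n θ * G j θ ∂μ) atTop (nhds (S n)))
    (hS0 : Tendsto (fun n : ℕ => S n) atTop (nhds 0)) :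
    Tendsto (fun n : ℕ => S (-n)) atTop (nhds 0) := by
  let 𝒰 : Ultrafilter ℕ := hyperfilter ℕ
  have h𝒰 : (𝒰 : Filter ℕ) ≤ atTop := by
    rw [← Nat.cofinite_eq_atTop]; exact hyperfilter_le_cofinite
  have hGn : ∀ j, Integrable (fun θ => ((‖G j θ‖ : ℝ) : ℂ)) μ := fun j => (hG j).norm.ofReal
  have hGnM : ∀ j, ∫ θ, ‖((‖G j θ‖ : ℝ) : ℂ)‖ ∂μ ≤ M := fun j => by simpa using hM j
  have hxy : ∀ x y : TP, Continuous (fun θ => starRingEnd ℂ (x.1 θ) * y.1 θ) ∧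
      ∃ K : ℝ, 0 ≤ K ∧ ∀ θ, ‖starRingEnd ℂ (x.1 θ) * y.1 θ‖ ≤ K := by
    intro x y
    obtain ⟨c1, K1, p1, b1⟩ := TP_prop x.1 x.2
    obtain ⟨c2, K2, p2, b2⟩ := TP_prop y.1 y.2
    refine ⟨(Complex.continuous_conj.comp c1).mul c2, K1 * K2, by positivity, fun θ => ?_⟩
    rw [norm_mul, RCLike.norm_conj]
    gcongr
    · exact b1 θ
    · exact b2 θ
  have hqi : ∀ x y : TP, ∀ j, Integrable (fun θ => starRingEnd ℂ (x.1 θ) * y.1 θ * ((‖G j θ‖ : ℝ) : ℂ)) μ := by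
    intro x y j
    obtain ⟨c, K, p, b⟩ := hxy x y
    exact TP_int _ c b (hGn j)
  have hBex : ∀ x y : TP, ∃ L, Tendsto (fun j => ∫ θ, starRingEnd ℂ (x.1 θ) * y.1 θ * ((‖G j θ‖ : ℝ) : ℂ) ∂μ) 𝒰 (nhds L) := by
    intro x y
    obtain ⟨c, K, p, b⟩ := hxy x y
    exact ultra_lim _ _ (K * M) fun j => TP_le _ c p b (hGn j) (hGnM j)
  choose B hB using hBex
  have hLex : ∀ x : TP, ∃ L, Tendsto (fun j => ∫ θ, x.1 θ * G j θ ∂μ) 𝒰 (nhds L) := by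
    intro x
    obtain ⟨c, K, p, b⟩ := TP_prop x.1 x.2
    exact ultra_lim _ _ (K * M) fun j => TP_le _ c p b (hG j) (hM j)
  choose Λ₀ hΛ₀ using hLex
  have hLi : ∀ x : TP, ∀ j, Integrable (fun θ => x.1 θ * G j θ) μ := by
    intro x j
    obtain ⟨c, K, p, b⟩ := TP_prop x.1 x.2
    exact TP_int _ c b (hG j)
  let Λ : TP →ₗ[ℂ] ℂ :=
    { toFun := Λ₀
      map_add' := fun x y => by
        refine tendsto_nhds_unique (hΛ₀ (x + y)) (((hΛ₀ x).add (hΛ₀ y)).congr fun j => ?_)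
        rw [← integral_add (hLi x j) (hLi y j)]
        congr 1; ext θ; simp [add_mul]
      map_smul' := fun a x => by
        refine tendsto_nhds_unique (hΛ₀ (a • x)) (((hΛ₀ x).const_mul a).congr fun j => ?_)
        rw [← integral_const_mul]
        congr 1; ext θ; simp [mul_assoc] }
  have hreal : ∀ x : TP, ∀ j, ∫ θ, starRingEnd ℂ (x.1 θ) * x.1 θ * ((‖G j θ‖ : ℝ) : ℂ) ∂μ
      = ((∫ θ, ‖x.1 θ‖ ^ 2 * ‖G j θ‖ ∂μ : ℝ) : ℂ) := by
    intro x j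
    rw [← integral_complex_ofReal]
    congr 1; ext θ
    rw [Complex.conj_mul']; push_cast; rfl
  have hBre : ∀ x : TP, Tendsto (fun j => ∫ θ, ‖x.1 θ‖ ^ 2 * ‖G j θ‖ ∂μ) 𝒰 (nhds (B x x).re) := by
    intro x
    refine ((Complex.continuous_re.tendsto _).comp (hB x x)).congr fun j => ?_
    simp only [Function.comp, hreal, Complex.ofReal_re]
  let c : PreInnerProductSpace.Core ℂ TP :=
    { inner := B
      conj_inner_symm := fun x y => by
        refine tendsto_nhds_unique ((Complex.continuous_conj.tendsto _).comp (hB y x)) ((hB x y).congr fun j => ?_)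
        simp only [Function.comp]
        rw [← integral_conj]
        congr 1; ext θ; simp only [map_mul, Complex.conj_conj, Complex.conj_ofReal]; ring
      re_inner_nonneg := fun x => by
        refine ge_of_tendsto' (hBre x) fun j => ?_
        positivity
      add_left := fun x y z => by
        refine tendsto_nhds_unique (hB (x + y) z) (((hB x z).add (hB y z)).congr fun j => ?_)
        rw [← integral_add (hqi x z j) (hqi y z j)]
        congr 1; ext θ; simp [add_mul]
      smul_left := fun x y a => by
        refine tendsto_nhds_unique (hB (a • x) y) (((hB x y).const_mul _).congr fun j => ?_)
        rw [← integral_const_mul]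
        congr 1; ext θ; simp [mul_assoc] }
  let U : ℤ → TP → TP := fun n x => ⟨EE n * x.1, TP_mul n x.1 x.2⟩
  have hΛE : ∀ n : ℤ, ∀ h, Λ ⟨EE n, h⟩ = S n := by
    intro n h
    exact tendsto_nhds_unique (hΛ₀ ⟨EE n, h⟩) ((hS n).mono_left h𝒰)
  have hEm : ∀ n, EE n ∈ TP := fun n => Submodule.subset_span ⟨n, rfl⟩
  have := weak_sym' c U ?_ ?_ ?_ Λ M hM0.le ?_ ?_ ⟨EE 0, hEm 0⟩
  · refine this.congr fun n => ?_
    rw [← hΛE _ (hEm _)]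
    congr 1
    ext θ
    simp [U, EE_zero]
  · intro n x y
    refine tendsto_nhds_unique (hB (U n x) (U n y)) ((hB x y).congr fun j => ?_)
    congr 1; ext θ
    have : starRingEnd ℂ (EE n θ) * EE n θ = 1 := by rw [Complex.conj_mul', EE_norm]; simp
    simp only [U, Pi.mul_apply, map_mul]
    linear_combination (- (starRingEnd ℂ (x.1 θ)) * y.1 θ * ((‖G j θ‖ : ℝ) : ℂ)) * this
  · intro m n x
    ext θ
    simp [U, EE_add, mul_assoc]
  · intro x; ext θ; simp [U, EE_zero]
  · intro x
    refine le_of_tendsto_of_tendsto' ((hΛ₀ x).norm.pow 2) ((hBre x).const_mul M) fun j => ?_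
    obtain ⟨cc, K, p, b⟩ := TP_prop x.1 x.2
    set N := ‖∫ θ, x.1 θ * G j θ ∂μ‖ with hN
    have hint2 : Integrable (fun θ => ‖x.1 θ‖ ^ 2 * ‖G j θ‖) μ := by
      refine (hqi x x j).norm.congr (Eventually.of_forall fun θ => ?_)
      simp only [norm_mul, RCLike.norm_conj, Complex.norm_real, norm_norm]; ring
    have h1 : 2 * (N / M) * N ≤ (N / M) ^ 2 * M + ∫ θ, ‖x.1 θ‖ ^ 2 * ‖G j θ‖ ∂μ := by
      calc 2 * (N / M) * N ≤ 2 * (N / M) * ∫ θ, ‖x.1 θ * G j θ‖ ∂μ := by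
            gcongr; exact norm_integral_le_integral_norm _
        _ = ∫ θ, 2 * (N / M) * ‖x.1 θ * G j θ‖ ∂μ := (integral_const_mul _ _).symm
        _ ≤ ∫ θ, ((N / M) ^ 2 * ‖G j θ‖ + ‖x.1 θ‖ ^ 2 * ‖G j θ‖) ∂μ := by
            refine integral_mono ((hLi x j).norm.const_mul _) (((hG j).norm.const_mul _).add hint2) fun θ => ?_
            simp only [norm_mul]
            nlinarith [mul_nonneg (sq_nonneg (N / M - ‖x.1 θ‖)) (norm_nonneg (G j θ))]
        _ = (N / M) ^ 2 * ∫ θ, ‖G j θ‖ ∂μ + ∫ θ, ‖x.1 θ‖ ^ 2 * ‖G j θ‖ ∂μ := by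
            rw [integral_add ((hG j).norm.const_mul _) hint2, integral_const_mul]
        _ ≤ _ := by gcongr; exact hM j
    have h2 : N ^ 2 / M ≤ ∫ θ, ‖x.1 θ‖ ^ 2 * ‖G j θ‖ ∂μ := by
      have : 2 * (N / M) * N - (N / M) ^ 2 * M = N ^ 2 / M := by field_simp; ring
      linarith
    rwa [div_le_iff₀' hM0] at h2
  · intro x
    have key : ∀ y (hy : y ∈ TP), Tendsto (fun n : ℕ => Λ (U n ⟨y, hy⟩)) atTop (nhds 0) := by
      intro y hy
      induction hy using Submodule.span_induction with
      | mem y h =>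
        obtain ⟨m, rfl⟩ := h
        have h1 : ∀ n : ℕ, Λ (U n ⟨EE m, hEm m⟩) = S (n + m) := by
          intro n
          rw [← hΛE _ (hEm _)]
          congr 1; ext θ; simp [U, EE_add]
        refine Tendsto.congr (fun n => (h1 n).symm) ?_
        have h2 : Tendsto (fun n : ℕ => (n + m : ℤ).toNat) atTop atTop := by
          refine tendsto_atTop.2 fun b => ?_
          filter_upwards [eventually_ge_atTop (b + m.natAbs)] with n hn
          omega
        refine (hS0.comp h2).congr' ?_
        filter_upwards [eventually_ge_atTop (m.natAbs)] with n hn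
        simp only [Function.comp]
        congr 1
        omega
      | zero =>
        refine tendsto_const_nhds.congr fun n => ?_
        rw [← map_zero Λ]; congr 1; ext θ; simp [U]
      | add y z hy hz h1 h2 =>
        have := h1.add h2
        rw [add_zero] at this
        refine this.congr fun n => ?_
        rw [← map_add]; congr 1; ext θ; simp [U, mul_add]
      | smul a y hy h1 =>
        have := h1.const_mul a
        rw [mul_zero] at this
        refine this.congr fun n => ?_
        rw [← smul_eq_mul, ← map_smul]; congr 1; ext θ; simp [U, mul_left_comm]
    exact key x.1 x.2
lemma EE_deriv (m : ℤ) (θ : ℝ) : HasDerivAt (EE m) (m * Complex.I * EE m θ) θ := by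
  have h1 : HasDerivAt (fun θ : ℝ => ((m : ℂ) * θ * Complex.I)) (m * Complex.I) θ := by
    have := ((Complex.ofRealCLM.hasDerivAt (x := θ)).const_mul (m : ℂ)).mul_const Complex.I
    simpa using this
  have := h1.cexp
  rw [mul_comm] at this
  exact this

lemma byparts (α β : ℝ) (u u' : ℝ → ℂ) (hu : ∀ x, HasDerivAt u (u' x) x) (hc : Continuous u')
    (h1 : u α = 0) (h2 : u β = 0) (m : ℤ) :
    |(m : ℝ)| * ‖∫ θ in α..β, EE m θ * u θ‖ = ‖∫ θ in α..β, EE m θ * u' θ‖ := by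
  have := intervalIntegral.integral_mul_deriv_eq_deriv_mul (a := α) (b := β) (u := EE m) (v := u)
    (u' := fun θ => m * Complex.I * EE m θ) (v' := u') (fun x _ => EE_deriv m x) (fun x _ => hu x)
    ((continuous_const.mul (EE_cont m)).intervalIntegrable _ _) (hc.intervalIntegrable _ _)
  rw [this, h1, h2]
  simp only [mul_assoc, intervalIntegral.integral_const_mul]
  simp

/-- The bump. -/
noncomputable def bump (α β : ℝ) (θ : ℝ) : ℝ := (θ - α) ^ 2 * (β - θ) ^ 2

/-- Its transform. -/
noncomputable def Phi (α β : ℝ) (m : ℤ) : ℂ := ∫ θ in α..β, EE m θ * (bump α β θ : ℂ)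

lemma bump_cont (α β : ℝ) : Continuous (bump α β) := by unfold bump; fun_prop

lemma Phi_summable (α β : ℝ) : Summable (fun m => ‖Phi α β m‖) := by
  let q1 : ℝ → ℝ := fun θ => 2 * (θ - α) * (β - θ) ^ 2 - 2 * (θ - α) ^ 2 * (β - θ)
  let q2 : ℝ → ℝ := fun θ => 2 * (β - θ) ^ 2 - 8 * (θ - α) * (β - θ) + 2 * (θ - α) ^ 2
  have d1 : ∀ x, HasDerivAt (fun θ => (bump α β θ : ℂ)) ((q1 x : ℂ)) x := by
    intro x
    have e1 : HasDerivAt (fun θ : ℝ => θ - α) 1 x := (hasDerivAt_id x).sub_const α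
    have e2 : HasDerivAt (fun θ : ℝ => β - θ) (-1) x := (hasDerivAt_id x).const_sub β
    refine HasDerivAt.ofReal_comp ?_
    refine ((e1.pow 2).mul (e2.pow 2)).congr_deriv ?_
    simp [q1]; ring
  have d2 : ∀ x, HasDerivAt (fun θ => (q1 θ : ℂ)) ((q2 x : ℂ)) x := by
    intro x
    have e1 : HasDerivAt (fun θ : ℝ => θ - α) 1 x := (hasDerivAt_id x).sub_const α
    have e2 : HasDerivAt (fun θ : ℝ => β - θ) (-1) x := (hasDerivAt_id x).const_sub β
    refine HasDerivAt.ofReal_comp ?_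
    refine (((e1.const_mul 2).mul (e2.pow 2)).sub (((e1.pow 2).const_mul 2).mul e2)).congr_deriv ?_
    simp [q2]; ring
  have c1 : Continuous (fun θ => (q1 θ : ℂ)) := by fun_prop
  have c2 : Continuous (fun θ => (q2 θ : ℂ)) := by fun_prop
  set K := |∫ θ in α..β, ‖(q2 θ : ℂ)‖| with hK
  have b : ∀ m : ℤ, |(m : ℝ)| * (|(m : ℝ)| * ‖Phi α β m‖) ≤ K := by
    intro m
    rw [Phi, byparts α β _ _ d1 c1 (by simp [bump]) (by simp [bump]),
      byparts α β _ _ d2 c2 (by simp [q1]) (by simp [q1])]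
    refine (intervalIntegral.norm_integral_le_abs_integral_norm).trans (le_of_eq ?_)
    simp only [norm_mul, EE_norm, one_mul, hK]
  have hs : Summable (fun m : ℤ => K * (1 / (m : ℝ) ^ 2)) :=
    (Real.summable_one_div_int_pow.2 (by norm_num)).mul_left K
  refine Summable.of_norm_bounded_eventually hs ?_
  have : ∀ᶠ m : ℤ in cofinite, m ≠ 0 := by
    exact (Set.finite_singleton (0 : ℤ)).compl_mem_cofinite
  filter_upwards [this] with m hm
  have hm' : (0 : ℝ) < |(m : ℝ)| := abs_pos.2 (by exact_mod_cast hm)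
  rw [norm_norm, mul_one_div, le_div_iff₀ (by rw [← sq_abs]; positivity), ← sq_abs]
  have := b m
  nlinarith

lemma exp_infinite (α β : ℝ) (h : α < β) :
    (Set.image (fun θ : ℝ => Complex.exp (θ * Complex.I)) (Ioo α β)).Infinite := by
  have hsub : Ioo α (min β (α + 1)) ⊆ Ioo α β := Ioo_subset_Ioo_right (min_le_left _ _)
  refine Set.Infinite.mono (image_mono hsub) ?_
  refine Set.Infinite.image ?_ (Ioo_infinite (by simp [h]))
  intro x hx y hy hxy
  obtain ⟨n, hn⟩ := Complex.exp_eq_exp_iff_exists_int.1 hxy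
  have h1 : x = y + n * (2 * Real.pi) := by
    have := congrArg Complex.im hn
    simpa using this
  have hx2 := lt_min_iff.1 hx.2
  have hy2 := lt_min_iff.1 hy.2
  have : |(n : ℝ)| < 1 := by
    rw [abs_lt]
    have := Real.pi_gt_three
    have := hx.1
    have := hy.1
    constructor <;> nlinarith
  have hn0 : n = 0 := by
    have : |n| < 1 := by exact_mod_cast this
    exact Int.abs_lt_one_iff.1 this
  simpa [hn0] using h1

lemma EE_eq_pow (n : ℕ) (θ : ℝ) : EE n θ = Complex.exp (θ * Complex.I) ^ n := by
  rw [← Complex.exp_nat_mul]; simp [EE, mul_assoc]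

lemma trig_unique (α β : ℝ) (h : α < β) (s : Finset ℤ) (c : ℤ → ℂ)
    (hz : ∀ l : ℤ, ∑ n ∈ s, c n * Phi α β (n + l) = 0) : ∀ n ∈ s, c n = 0 := by
  let P : ℝ → ℂ := fun θ => ∑ n ∈ s, c n * EE n θ
  have hPc : Continuous P := by
    refine continuous_finsetSum _ fun n _ => continuous_const.mul (EE_cont n)
  have h0 : ∫ θ in α..β, ‖P θ‖ ^ 2 * bump α β θ = 0 := by
    have h1 : ((∫ θ in α..β, ‖P θ‖ ^ 2 * bump α β θ : ℝ) : ℂ) = 0 := by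
      rw [← intervalIntegral.integral_ofReal]
      have e1 : ∀ θ, ((‖P θ‖ ^ 2 * bump α β θ : ℝ) : ℂ) =
          ∑ l ∈ s, ∑ n ∈ s, starRingEnd ℂ (c l) * (c n * (EE (n + -l) θ * bump α β θ)) := by
        intro θ
        push_cast
        rw [← Complex.conj_mul']
        simp only [P, map_sum, map_mul, EE_conj, Finset.sum_mul, Finset.mul_sum, EE_add]
        rw [Finset.sum_comm]
        refine Finset.sum_congr rfl fun l _ => Finset.sum_congr rfl fun n _ => ?_
        ring
      simp only [e1]
      have hint : ∀ l n : ℤ, Continuous (fun θ => starRingEnd ℂ (c l) * (c n * (EE (n + -l) θ * bump α β θ))) := by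
        intro l n
        exact continuous_const.mul (continuous_const.mul ((EE_cont _).mul (Complex.continuous_ofReal.comp (bump_cont α β))))
      rw [intervalIntegral.integral_finsetSum]
      · refine Finset.sum_eq_zero fun l _ => ?_
        rw [intervalIntegral.integral_finsetSum]
        · simp only [intervalIntegral.integral_const_mul]
          rw [← Finset.mul_sum]
          have := hz (-l)
          simp only [Phi] at this
          rw [this, mul_zero]
        · intro n _; exact (hint l n).intervalIntegrable _ _
      · intro l _
        exact (continuous_finsetSum _ fun n _ => hint l n).intervalIntegrable _ _
    exact_mod_cast h1
  have hP0 : ∀ θ ∈ Ioo α β, P θ = 0 := by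
    intro θ hθ
    by_contra hne
    have := intervalIntegral.integral_pos (f := fun θ => ‖P θ‖ ^ 2 * bump α β θ) h
      ((hPc.norm.pow 2).mul (bump_cont α β)).continuousOn
      (fun x _ => by unfold bump; positivity) ⟨θ, ⟨hθ.1.le, hθ.2.le⟩, by
        have h1 : 0 < θ - α := by linarith [hθ.1]
        have h2 : 0 < β - θ := by linarith [hθ.2]
        have h3 : 0 < ‖P θ‖ := norm_pos_iff.2 hne
        unfold bump; positivity⟩
    linarith
  let K : ℕ := ∑ n ∈ s, n.natAbs
  have hK : ∀ n ∈ s, 0 ≤ n + K := by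
    intro n hn
    have : n.natAbs ≤ K := Finset.single_le_sum (f := fun n : ℤ => n.natAbs) (fun _ _ => Nat.zero_le _) hn
    omega
  let p : Polynomial ℂ := ∑ n ∈ s, Polynomial.C (c n) * Polynomial.X ^ ((n + K).toNat)
  have hp : p = 0 := by
    refine Polynomial.eq_zero_of_infinite_isRoot p (Set.Infinite.mono ?_ (exp_infinite α β h))
    rintro _ ⟨θ, hθ, rfl⟩
    have : p.eval (Complex.exp (θ * Complex.I)) = EE K θ * P θ := by
      simp only [p, P, Polynomial.eval_finsetSum, Finset.mul_sum]
      refine Finset.sum_congr rfl fun n hn => ?_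
      simp only [Polynomial.eval_mul, Polynomial.eval_C, Polynomial.eval_pow, Polynomial.eval_X]
      rw [← EE_eq_pow, Int.toNat_of_nonneg (hK n hn), EE_add]; ring
    simp only [mem_ofPred_eq, Polynomial.IsRoot.def]
    rw [this, hP0 θ hθ, mul_zero]
  intro n hn
  have := congrArg (fun q => Polynomial.coeff q ((n + K).toNat)) hp
  simp only [p, Polynomial.finsetSum_coeff, Polynomial.coeff_C_mul, Polynomial.coeff_X_pow,
    Polynomial.coeff_zero] at this
  rw [Finset.sum_eq_single n] at this
  · simpa using this
  · intro m hm hmn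
    rw [if_neg, mul_zero]
    intro h
    have := hK m hm
    have := hK n hn
    omega
  · intro h; exact absurd hn h

/-- extension by zero -/
def extA (a : ℕ → ℂ) (n : ℤ) : ℂ := if 0 ≤ n then a n.toNat else 0

lemma extA_norm (a : ℕ → ℂ) (C : ℝ) (hC : ∀ n, ‖a n‖ ≤ C) (n : ℤ) : ‖extA a n‖ ≤ C := by
  unfold extA
  split_ifs
  · exact hC _
  · simpa using (norm_nonneg _).trans (hC 0)

/-- pairing -/
noncomputable def SS (α β : ℝ) (a : ℕ → ℂ) (k : ℤ) : ℂ := ∑' m : ℤ, extA a (m - k) * Phi α β m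

lemma SS_nat (α β : ℝ) (a : ℕ → ℂ) (k : ℤ) : SS α β a k = ∑' n : ℕ, a n * Phi α β (n + k) := by
  unfold SS
  rw [← (Equiv.addRight k).tsum_eq]
  simp only [Equiv.coe_addRight, add_sub_cancel_right]
  rw [← (Nat.cast_injective (R := ℤ)).tsum_eq]
  · simp [extA]
  · intro n hn
    by_contra h
    apply hn
    have : ¬ 0 ≤ n := fun h0 => h ⟨n.toNat, by simp [h0]⟩
    simp [extA, this]

lemma SS_pos (α β : ℝ) (a : ℕ → ℂ) (C : ℝ) (hC : ∀ n, ‖a n‖ ≤ C) :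
    Tendsto (fun n : ℕ => SS α β a n) atTop (nhds 0) := by
  have := tendsto_tsum_of_dominated_convergence (𝓕 := (atTop : Filter ℕ))
    (f := fun (n : ℕ) (m : ℤ) => extA a (m - n) * Phi α β m) (g := fun _ => 0)
    (bound := fun m => C * ‖Phi α β m‖) ((Phi_summable α β).mul_left C) ?_ ?_
  · simp only [tsum_zero] at this
    exact this
  · intro m
    refine tendsto_const_nhds.congr' ?_
    filter_upwards [eventually_gt_atTop m.natAbs] with n hn
    have : ¬ (0 : ℤ) ≤ m - n := by omega
    rw [extA, if_neg this, zero_mul]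
  · refine Eventually.of_forall fun n m => ?_
    rw [norm_mul]
    gcongr
    exact extA_norm a C hC _

lemma FF_hasSum (a : ℕ → ℂ) (r : ℝ) (θ : ℝ) (n : ℕ) :
    a n * ((r : ℂ) * Complex.exp (θ * Complex.I)) ^ n = a n * (r : ℂ) ^ n * EE n θ := by
  rw [mul_pow, EE_eq_pow]; ring

lemma FF_cont (a : ℕ → ℂ) (C : ℝ) (hC : ∀ n, ‖a n‖ ≤ C) (r : ℝ) (h0 : 0 < r) (h1 : r < 1) :
    Continuous (fun θ : ℝ => ∑' n : ℕ, a n * ((r : ℂ) * Complex.exp (θ * Complex.I)) ^ n) := by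
  refine continuous_tsum (u := fun n => C * r ^ n) (fun n => by fun_prop)
    ((summable_geometric_of_lt_one h0.le h1).mul_left C) fun n θ => ?_
  rw [FF_hasSum, norm_mul, norm_mul, EE_norm, mul_one, norm_pow, Complex.norm_real, Real.norm_of_nonneg h0.le]
  gcongr
  exact hC n

lemma FF_int (α β : ℝ) (a : ℕ → ℂ) (C : ℝ) (hC : ∀ n, ‖a n‖ ≤ C) (r : ℝ) (h0 : 0 < r) (h1 : r < 1) (k : ℤ) :
    ∫ θ in α..β, EE k θ * ((bump α β θ : ℂ) * ∑' n : ℕ, a n * ((r : ℂ) * Complex.exp (θ * Complex.I)) ^ n)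
      = ∑' n : ℕ, a n * (r : ℂ) ^ n * Phi α β (n + k) := by
  have hs : Summable (fun n : ℕ => C * r ^ n) := (summable_geometric_of_lt_one h0.le h1).mul_left C
  have hb : ∀ n : ℕ, ‖a n * (r : ℂ) ^ n‖ ≤ C * r ^ n := by
    intro n
    rw [norm_mul, norm_pow, Complex.norm_real, Real.norm_of_nonneg h0.le]
    gcongr
    exact hC n
  have := intervalIntegral.hasSum_integral_of_dominated_convergence (μ := volume) (a := α) (b := β)
    (F := fun (n : ℕ) θ => a n * (r : ℂ) ^ n * (EE (n + k) θ * (bump α β θ : ℂ)))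
    (f := fun θ => EE k θ * ((bump α β θ : ℂ) * ∑' n : ℕ, a n * ((r : ℂ) * Complex.exp (θ * Complex.I)) ^ n))
    (fun n θ => C * r ^ n * ‖bump α β θ‖) ?_ ?_ ?_ ?_ ?_
  · rw [← this.tsum_eq]
    simp only [intervalIntegral.integral_const_mul, Phi]
  · intro n
    refine Continuous.aestronglyMeasurable ?_
    exact continuous_const.mul ((EE_cont _).mul (Complex.continuous_ofReal.comp (bump_cont α β)))
  · intro n
    refine Eventually.of_forall fun θ _ => ?_
    rw [norm_mul, norm_mul (EE _ _), EE_norm, one_mul, Complex.norm_real]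
    gcongr
    exact hb n
  · exact Eventually.of_forall fun θ _ => hs.mul_right _
  · simp only [tsum_mul_right]
    exact (continuous_const.mul (bump_cont α β).norm).intervalIntegrable _ _
  · refine Eventually.of_forall fun θ _ => ?_
    have hsum : Summable (fun n : ℕ => a n * (r : ℂ) ^ n * EE n θ) := by
      refine Summable.of_norm_bounded hs fun n => ?_
      rw [norm_mul, EE_norm, mul_one]; exact hb n
    have := (hsum.hasSum.mul_left (EE k θ * (bump α β θ : ℂ)))
    simp only [FF_hasSum]
    rw [← mul_assoc]
    have e : (fun n : ℕ => a n * (r : ℂ) ^ n * (EE (n + k) θ * (bump α β θ : ℂ)))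
        = fun n : ℕ => EE k θ * (bump α β θ : ℂ) * (a n * (r : ℂ) ^ n * EE n θ) := by
      ext n; rw [EE_add]; ring
    rw [e]; exact this

lemma SS_neg (α β : ℝ) (hαβ : α < β) (a : ℕ → ℂ) (C : ℝ) (hC : ∀ n, ‖a n‖ ≤ C) (M : ℝ)
    (hM : ∀ r : ℝ, 0 < r → r < 1 →
      ∫ θ in α..β, ‖∑' n : ℕ, a n * ((r : ℂ) * Complex.exp (θ * Complex.I)) ^ n‖ ≤ M) :
    Tendsto (fun n : ℕ => SS α β a (-n)) atTop (nhds 0) := by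
  let r : ℕ → ℝ := fun j => 1 - 1 / ((j : ℝ) + 2)
  have hr0 : ∀ j, 0 < r j := fun j => by
    have : (0 : ℝ) ≤ j := by positivity
    simp only [r, sub_pos]; rw [div_lt_one (by positivity)]; linarith
  have hr1 : ∀ j, r j < 1 := fun j => by
    have : (0 : ℝ) < 1 / ((j : ℝ) + 2) := by positivity
    simp only [r]; linarith
  have hrl : Tendsto r atTop (nhds 1) := by
    have : Tendsto (fun j : ℕ => 1 / ((j : ℝ) + 2)) atTop (nhds 0) :=
      tendsto_const_nhds.div_atTop (tendsto_atTop_add_const_right _ _ tendsto_natCast_atTop_atTop)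
    have h := this.const_sub 1
    rw [sub_zero] at h
    exact h
  let F : ℕ → ℝ → ℂ := fun j θ => ∑' n : ℕ, a n * ((r j : ℂ) * Complex.exp (θ * Complex.I)) ^ n
  have hFc : ∀ j, Continuous (F j) := fun j => FF_cont a C hC (r j) (hr0 j) (hr1 j)
  let G : ℕ → ℝ → ℂ := fun j θ => (bump α β θ : ℂ) * F j θ
  have hGc : ∀ j, Continuous (G j) := fun j => (Complex.continuous_ofReal.comp (bump_cont α β)).mul (hFc j)
  let b : ℝ := (β - α) ^ 4
  have hb : ∀ θ ∈ Icc α β, |bump α β θ| ≤ b := by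
    intro θ hθ
    have h1 : 0 ≤ θ - α := by linarith [hθ.1]
    have h2 : 0 ≤ β - θ := by linarith [hθ.2]
    have h3 : θ - α ≤ β - α := by linarith [hθ.2]
    have h4 : β - θ ≤ β - α := by linarith [hθ.1]
    rw [abs_of_nonneg (by unfold bump; positivity)]
    calc bump α β θ ≤ (β - α) ^ 2 * (β - α) ^ 2 := by unfold bump; gcongr
      _ = b := by simp only [b]; ring
  refine rajchman (volume.restrict (Ioc α β)) G (b * |M| + 1) (by positivity) ?_ ?_ (SS α β a) ?_ (SS_pos α β a C hC)
  · intro j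
    have := (hGc j).intervalIntegrable (μ := volume) α β
    rwa [intervalIntegrable_iff_integrableOn_Ioc_of_le hαβ.le] at this
  · intro j
    rw [← intervalIntegral.integral_of_le hαβ.le]
    calc ∫ θ in α..β, ‖G j θ‖ ≤ ∫ θ in α..β, b * ‖F j θ‖ := by
          refine intervalIntegral.integral_mono_on hαβ.le ((hGc j).norm.intervalIntegrable _ _)
            ((continuous_const.mul (hFc j).norm).intervalIntegrable _ _) fun θ hθ => ?_
          simp only [G, norm_mul, Complex.norm_real, Real.norm_eq_abs]
          gcongr
          exact hb θ hθ
      _ = b * ∫ θ in α..β, ‖F j θ‖ := intervalIntegral.integral_const_mul _ _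
      _ ≤ b * |M| := by gcongr; exact (hM _ (hr0 j) (hr1 j)).trans (le_abs_self _)
      _ ≤ _ := by linarith
  · intro k
    simp only [← intervalIntegral.integral_of_le hαβ.le]
    simp only [G, F, FF_int α β a C hC _ (hr0 _) (hr1 _), SS_nat]
    refine tendsto_tsum_of_dominated_convergence (bound := fun n : ℕ => C * ‖Phi α β (n + k)‖) ?_ ?_ ?_
    · refine Summable.mul_left C ?_
      exact (Phi_summable α β).comp_injective (i := fun n : ℕ => (n : ℤ) + k) (fun m n h => by simpa using h)
    · intro n
      have : Tendsto (fun j => ((r j : ℝ) : ℂ)) atTop (nhds ((1 : ℝ) : ℂ)) :=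
        (Complex.continuous_ofReal.tendsto _).comp hrl
      have := ((this.pow n).const_mul (a n)).mul_const (Phi α β (n + k))
      simpa using this
    · refine Eventually.of_forall fun j n => ?_
      rw [norm_mul, norm_mul, norm_pow, Complex.norm_real, Real.norm_of_nonneg (hr0 j).le]
      have := pow_le_one₀ (hr0 j).le (hr1 j).le (n := n)
      have h2 := pow_nonneg (hr0 j).le n
      gcongr
      calc ‖a n‖ * r j ^ n ≤ ‖a n‖ * 1 := by gcongr
        _ ≤ C := by simpa using hC n

lemma exists_hit (T : Metric.sphere (0 : ℂ) 1 ≃ₜ Metric.sphere (0 : ℂ) 1)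
    (hdense : ∀ z : Metric.sphere (0 : ℂ) 1,
      Dense {x : Metric.sphere (0 : ℂ) 1 | ∃ k : ℕ, (⇑T)^[k] z = x})
    (z : Metric.sphere (0 : ℂ) 1) (u v : ℝ) (huv : u < v) :
    ∃ k : ℕ, ∃ ϑ ∈ Ioo u v, (((⇑T)^[k] z : Metric.sphere (0 : ℂ) 1) : ℂ) = Complex.exp (ϑ * Complex.I) := by
  set t := (u + v) / 2 with ht
  let p : Metric.sphere (0 : ℂ) 1 := ⟨Complex.exp (t * Complex.I), by
    simp [Complex.norm_exp_ofReal_mul_I]⟩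
  let g : Metric.sphere (0 : ℂ) 1 → ℝ := fun x => Complex.arg ((x : ℂ) * Complex.exp (-(t * Complex.I)))
  have hg0 : (p : ℂ) * Complex.exp (-(t * Complex.I)) = 1 := by
    simp only [p, ← Complex.exp_add]; simp
  have hg : ContinuousAt g p := by
    refine ContinuousAt.comp (f := fun x : Metric.sphere (0 : ℂ) 1 => (x : ℂ) * Complex.exp (-(t * Complex.I)))
      (g := Complex.arg) ?_ (by fun_prop)
    rw [hg0]
    exact Complex.continuousAt_arg (by simp)
  have hev : ∀ᶠ x in nhds p, |g x| < (v - u) / 2 := by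
    have h1 : Tendsto g (nhds p) (nhds 0) := by
      have : g p = 0 := by simp only [g, hg0, Complex.arg_one]
      simpa [ContinuousAt, this] using hg
    have := Metric.tendsto_nhds.1 h1 ((v - u) / 2) (by linarith)
    simpa using this
  obtain ⟨x, ⟨k, hk⟩, hx⟩ := (hdense z).inter_nhds_nonempty hev
  refine ⟨k, t + g x, ?_, ?_⟩
  · have hx2 : |g x| < (v - u) / 2 := hx
    have := abs_lt.1 hx2
    constructor <;> simp only [ht] <;> linarith [this.1, this.2]
  · rw [hk]
    have hn : ‖(x : ℂ) * Complex.exp (-(t * Complex.I))‖ = 1 := by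
      have h2 : Complex.exp (-(t * Complex.I)) = Complex.exp (((-t : ℝ) : ℂ) * Complex.I) := by simp
      rw [norm_mul, h2, Complex.norm_exp_ofReal_mul_I]
      simp
    have h3 := Complex.norm_mul_exp_arg_mul_I ((x : ℂ) * Complex.exp (-(t * Complex.I)))
    rw [hn, Complex.ofReal_one, one_mul] at h3
    push_cast
    rw [add_mul, Complex.exp_add]
    simp only [g]
    rw [h3, mul_comm (x : ℂ), ← mul_assoc, ← Complex.exp_add]
    simp

lemma sphere_infinite : Infinite (Metric.sphere (0 : ℂ) 1) := by
  rw [Set.infinite_coe_iff]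
  refine Set.Infinite.mono ?_ (exp_infinite 0 1 one_pos)
  rintro _ ⟨θ, _, rfl⟩
  simp [Complex.norm_exp_ofReal_mul_I]

lemma zpow_iter {X : Type*} [TopologicalSpace X] (T : X ≃ₜ X) (n : ℕ) (x : X) :
    (T ^ n) x = (⇑T)^[n] x := by
  induction n generalizing x with
  | zero => rfl
  | succ n ih => rw [pow_succ, Function.iterate_succ_apply, ← ih]; rfl

lemma orbit_inj (T : Metric.sphere (0 : ℂ) 1 ≃ₜ Metric.sphere (0 : ℂ) 1)
    (hdense : ∀ z : Metric.sphere (0 : ℂ) 1,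
      Dense {x : Metric.sphere (0 : ℂ) 1 | ∃ k : ℕ, (⇑T)^[k] z = x})
    (z : Metric.sphere (0 : ℂ) 1) : Function.Injective (fun k : ℤ => (T ^ k) z) := by
  have key : ∀ j k : ℤ, j < k → (T ^ j) z = (T ^ k) z → False := by
    intro j k hjk h
    obtain ⟨p, hp⟩ : ∃ p : ℕ, k = j + p := ⟨(k - j).toNat, by omega⟩
    have hp0 : 0 < p := by omega
    have h1 : (⇑T)^[p] z = z := by
      rw [hp, zpow_add, zpow_natCast] at h
      have h2 : (T ^ j) z = (T ^ j) ((T ^ p) z) := h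
      rw [← zpow_iter]
      exact ((T ^ j).injective h2).symm
    have hper : Function.IsPeriodicPt T p z := h1
    have hfin : {x : Metric.sphere (0 : ℂ) 1 | ∃ k : ℕ, (⇑T)^[k] z = x}.Finite := by
      refine ((Set.finite_Iio p).image (fun k => (⇑T)^[k] z)).subset ?_
      rintro x ⟨k, rfl⟩
      exact ⟨k % p, Nat.mod_lt _ hp0, hper.iterate_mod_apply k⟩
    have h3 := (hdense z).closure_eq
    rw [hfin.isClosed.closure_eq] at h3
    rw [h3] at hfin
    have := sphere_infinite
    exact Set.infinite_univ hfin
  intro j k h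
  rcases lt_trichotomy j k with h1 | h1 | h1
  · exact (key j k h1 h).elim
  · exact h1
  · exact (key k j h1 h.symm).elim

lemma SS_limit (α β : ℝ) (a : ℕ → ℂ) (C : ℝ) (hC : ∀ n, ‖a n‖ ≤ C)
    (hS : Tendsto (fun n : ℕ => SS α β a (-n)) atTop (nhds 0)) (𝒰 : Ultrafilter ℕ)
    (n : ℕ → ℕ) (hn : Tendsto n 𝒰 atTop) (b : ℤ → ℂ)
    (hb : ∀ k, Tendsto (fun j => extA a (k + n j)) 𝒰 (nhds (b k))) (l : ℤ) :
    ∑' m : ℤ, b (m - l) * Phi α β m = 0 := by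
  have h1 : Tendsto (fun j => SS α β a (l - n j)) 𝒰 (nhds (∑' m : ℤ, b (m - l) * Phi α β m)) := by
    unfold SS
    refine tendsto_tsum_of_dominated_convergence (bound := fun m : ℤ => C * ‖Phi α β m‖)
      ((Phi_summable α β).mul_left C) ?_ ?_
    · intro m
      refine Tendsto.mul_const _ ((hb (m - l)).congr fun j => ?_)
      congr 1; ring
    · refine Eventually.of_forall fun j m => ?_
      rw [norm_mul]
      gcongr
      exact extA_norm a C hC _
  have h2 : Tendsto (fun j => SS α β a (l - n j)) 𝒰 (nhds 0) := by
    have h3 : Tendsto (fun N : ℕ => SS α β a (l - N)) atTop (nhds 0) := by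
      have h4 : Tendsto (fun N : ℕ => (N - l : ℤ).toNat) atTop atTop := by
        refine tendsto_atTop.2 fun b => ?_
        filter_upwards [eventually_ge_atTop (b + l.natAbs)] with n hn
        omega
      refine (hS.comp h4).congr' ?_
      filter_upwards [eventually_ge_atTop (l.natAbs)] with n hn
      simp only [Function.comp]
      congr 1
      omega
    exact h3.comp hn
  exact tendsto_nhds_unique h1 h2

lemma right_limit (T : Metric.sphere (0 : ℂ) 1 ≃ₜ Metric.sphere (0 : ℂ) 1)
    (f : ℂ → ℂ) (C : ℝ)
    (hbd : ∀ z ∈ Metric.sphere (0 : ℂ) 1, ‖f z‖ ≤ C)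
    (D : Finset ℂ)
    (hcont : ∀ z ∈ Metric.sphere (0 : ℂ) 1 \ (D : Set ℂ),
      ContinuousWithinAt f (Metric.sphere (0 : ℂ) 1) z)
    (z x₀ : Metric.sphere (0 : ℂ) 1) (n : ℕ → ℕ) (hn : Tendsto n atTop atTop)
    (hx : Tendsto (fun j => (⇑T)^[n j] z) atTop (nhds x₀)) (L : ℂ)
    (hL : Tendsto (fun j => f ((⇑T)^[n j] z : Metric.sphere (0 : ℂ) 1)) atTop (nhds L))
    (𝒰 : Ultrafilter ℕ) (h𝒰 : (𝒰 : Filter ℕ) ≤ atTop) :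
    ∃ b : ℤ → ℂ, (∀ k, Tendsto (fun j => extA (fun n => f ((⇑T)^[n] z : Metric.sphere (0 : ℂ) 1)) (k + n j)) 𝒰 (nhds (b k)))
      ∧ b 0 = L ∧ ∀ k : ℤ, (((T ^ k) x₀ : Metric.sphere (0 : ℂ) 1) : ℂ) ∉ D → b k = f ((T ^ k) x₀ : Metric.sphere (0 : ℂ) 1) := by
  set a : ℕ → ℂ := fun n => f ((⇑T)^[n] z : Metric.sphere (0 : ℂ) 1) with ha
  have hC : ∀ n, ‖a n‖ ≤ C := fun n => hbd _ (Subtype.coe_prop _)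
  have hex : ∀ k : ℤ, ∃ L, Tendsto (fun j => extA a (k + n j)) 𝒰 (nhds L) := fun k =>
    ultra_lim 𝒰 _ C fun j => extA_norm a C hC _
  choose b hb using hex
  refine ⟨b, hb, ?_, ?_⟩
  · refine tendsto_nhds_unique (hb 0) ((hL.mono_left h𝒰).congr fun j => ?_)
    simp [extA, ha]
  · intro k hk
    refine tendsto_nhds_unique (hb k) ?_
    have h1 : Tendsto (fun j => (((T ^ k) ((⇑T)^[n j] z) : Metric.sphere (0 : ℂ) 1) : ℂ)) atTop
        (nhdsWithin (((T ^ k) x₀ : Metric.sphere (0 : ℂ) 1) : ℂ) (Metric.sphere (0 : ℂ) 1)) := by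
      refine tendsto_nhdsWithin_iff.2 ⟨?_, Eventually.of_forall fun j => Subtype.coe_prop _⟩
      exact (continuous_subtype_val.tendsto _).comp (((T ^ k).continuous.tendsto _).comp hx)
    have h2 := (hcont _ ⟨Subtype.coe_prop ((T ^ k) x₀), by simpa using hk⟩).tendsto.comp h1
    refine (h2.congr' ?_).mono_left h𝒰
    filter_upwards [hn.eventually (eventually_ge_atTop k.natAbs)] with j hj
    have h3 : 0 ≤ k + (n j : ℤ) := by omega
    simp only [Function.comp, extA, h3, if_true, ha]
    congr 2
    rw [← zpow_iter, ← zpow_iter, ← zpow_natCast T ((k + (n j : ℤ)).toNat), Int.toNat_of_nonneg h3, zpow_add, zpow_natCast]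
    rfl

lemma side_seq (T : Metric.sphere (0 : ℂ) 1 ≃ₜ Metric.sphere (0 : ℂ) 1)
    (hdense : ∀ z : Metric.sphere (0 : ℂ) 1,
      Dense {x : Metric.sphere (0 : ℂ) 1 | ∃ k : ℕ, (⇑T)^[k] z = x})
    (f : ℂ → ℂ) (z x₀ : Metric.sphere (0 : ℂ) 1) (θ₀ : ℝ) (hx₀ : (x₀ : ℂ) = Complex.exp (θ₀ * Complex.I))
    (s : Set ℝ) (u v : ℕ → ℝ) (huv : ∀ j, u j < v j) (hs : ∀ j, Ioo (u j) (v j) ⊆ s)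
    (hu : Tendsto u atTop (nhds θ₀)) (hv : Tendsto v atTop (nhds θ₀)) (L : ℂ)
    (hL : Tendsto (fun θ : ℝ => f (Complex.exp (θ * Complex.I))) (nhdsWithin θ₀ s) (nhds L)) :
    ∃ n : ℕ → ℕ, Tendsto n atTop atTop ∧ Tendsto (fun j => (⇑T)^[n j] z) atTop (nhds x₀) ∧
      Tendsto (fun j => f ((⇑T)^[n j] z : Metric.sphere (0 : ℂ) 1)) atTop (nhds L) := by
  have := fun j : ℕ => exists_hit T hdense ((⇑T)^[j] z) (u j) (v j) (huv j)
  choose k ϑ hϑ hk using this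
  have hk' : ∀ j, (((⇑T)^[k j + j] z : Metric.sphere (0 : ℂ) 1) : ℂ) = Complex.exp (ϑ j * Complex.I) := by
    intro j; rw [Function.iterate_add_apply]; exact hk j
  have hϑl : Tendsto ϑ atTop (nhds θ₀) :=
    tendsto_of_tendsto_of_tendsto_of_le_of_le hu hv (fun j => (hϑ j).1.le) (fun j => (hϑ j).2.le)
  refine ⟨fun j => k j + j, tendsto_atTop_mono (fun j => Nat.le_add_left j (k j)) tendsto_id, ?_, ?_⟩
  · rw [tendsto_subtype_rng]
    simp only [hk', hx₀]
    have : Continuous (fun θ : ℝ => Complex.exp (θ * Complex.I)) := by fun_prop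
    exact (this.tendsto _).comp hϑl
  · simp only [hk']
    exact hL.comp (tendsto_nhdsWithin_iff.2 ⟨hϑl, Eventually.of_forall fun j => hs j (hϑ j)⟩)

theorem stmt19 (T : Metric.sphere (0 : ℂ) 1 ≃ₜ Metric.sphere (0 : ℂ) 1)
    (hdense : ∀ z : Metric.sphere (0 : ℂ) 1,
      Dense {x : Metric.sphere (0 : ℂ) 1 | ∃ k : ℕ, (⇑T)^[k] z = x})
    (f : ℂ → ℂ) (C : ℝ)
    (hbd : ∀ z ∈ Metric.sphere (0 : ℂ) 1, ‖f z‖ ≤ C)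
    (D : Finset ℂ) (hD : (D : Set ℂ) ⊆ Metric.sphere (0 : ℂ) 1)
    (hcont : ∀ z ∈ Metric.sphere (0 : ℂ) 1 \ (D : Set ℂ),
      ContinuousWithinAt f (Metric.sphere (0 : ℂ) 1) z)
    (θ₀ : ℝ) (hθ₀ : Complex.exp (θ₀ * Complex.I) ∈ D)
    (L₁ L₂ : ℂ)
    (hL₁ : Tendsto (fun θ : ℝ => f (Complex.exp (θ * Complex.I)))
      (nhdsWithin θ₀ (Set.Ioi θ₀)) (nhds L₁))
    (hL₂ : Tendsto (fun θ : ℝ => f (Complex.exp (θ * Complex.I)))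
      (nhdsWithin θ₀ (Set.Iio θ₀)) (nhds L₂))
    (hne : L₁ ≠ L₂) :
    ∀ z : Metric.sphere (0 : ℂ) 1,
      StrongNaturalBoundary (fun w => ∑' n : ℕ, f (((⇑T)^[n] z : Metric.sphere (0 : ℂ) 1) : ℂ) * w ^ n) := by
  intro z α β hαβ
  rintro ⟨M, hM⟩
  set a : ℕ → ℂ := fun n => f (((⇑T)^[n] z : Metric.sphere (0 : ℂ) 1) : ℂ) with ha
  have hC : ∀ n, ‖a n‖ ≤ C := fun n => hbd _ (Subtype.coe_prop _)
  have hS : Tendsto (fun n : ℕ => SS α β a (-n)) atTop (nhds 0) := by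
    refine SS_neg α β hαβ a C hC (M * (2 * Real.pi)) fun r h0 h1 => ?_
    have := hM r h0 h1
    rwa [div_le_iff₀ (by positivity)] at this
  let 𝒰 : Ultrafilter ℕ := hyperfilter ℕ
  have h𝒰 : (𝒰 : Filter ℕ) ≤ atTop := by
    rw [← Nat.cofinite_eq_atTop]; exact hyperfilter_le_cofinite
  let x₀ : Metric.sphere (0 : ℂ) 1 := ⟨Complex.exp (θ₀ * Complex.I), hD hθ₀⟩
  have hδ : ∀ j : ℕ, (0 : ℝ) < 1 / ((j : ℝ) + 1) := fun j => by positivity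
  have hlim := tendsto_one_div_add_atTop_nhds_zero_nat (𝕜 := ℝ)
  obtain ⟨n₁, hn₁, hx₁, hf₁⟩ := side_seq T hdense f z x₀ θ₀ rfl (Ioi θ₀) (fun _ => θ₀)
    (fun j => θ₀ + 1 / ((j : ℝ) + 1)) (fun j => by linarith [hδ j]) (fun j x hx => hx.1)
    tendsto_const_nhds (by simpa using hlim.const_add θ₀) L₁ hL₁
  obtain ⟨n₂, hn₂, hx₂, hf₂⟩ := side_seq T hdense f z x₀ θ₀ rfl (Iio θ₀)
    (fun j => θ₀ - 1 / ((j : ℝ) + 1)) (fun _ => θ₀) (fun j => by linarith [hδ j]) (fun j x hx => hx.2)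
    (by simpa using hlim.const_sub θ₀) tendsto_const_nhds L₂ hL₂
  obtain ⟨b₁, hb₁, hb₁0, hb₁k⟩ := right_limit T f C hbd D hcont z x₀ n₁ hn₁ hx₁ L₁ hf₁ 𝒰 h𝒰
  obtain ⟨b₂, hb₂, hb₂0, hb₂k⟩ := right_limit T f C hbd D hcont z x₀ n₂ hn₂ hx₂ L₂ hf₂ 𝒰 h𝒰
  have hz₁ := SS_limit α β a C hC hS 𝒰 n₁ (hn₁.mono_left h𝒰) b₁ hb₁
  have hz₂ := SS_limit α β a C hC hS 𝒰 n₂ (hn₂.mono_left h𝒰) b₂ hb₂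
  have hfin : {k : ℤ | (((T ^ k) x₀ : Metric.sphere (0 : ℂ) 1) : ℂ) ∈ D}.Finite := by
    have := D.finite_toSet.preimage (f := fun k : ℤ => (((T ^ k) x₀ : Metric.sphere (0 : ℂ) 1) : ℂ))
      ((Subtype.val_injective.comp (orbit_inj T hdense x₀)).injOn)
    exact this
  have hnorm : ∀ (n : ℕ → ℕ) (b : ℤ → ℂ),
      (∀ k, Tendsto (fun j => extA a (k + n j)) 𝒰 (nhds (b k))) → ∀ k, ‖b k‖ ≤ C := by
    intro n b hb k
    exact le_of_tendsto' (hb k).norm fun j => extA_norm a C hC _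
  have hsum : ∀ b : ℤ → ℂ, (∀ k, ‖b k‖ ≤ C) → ∀ l, Summable (fun m : ℤ => b (m - l) * Phi α β m) := by
    intro b hb l
    refine Summable.of_norm_bounded ((Phi_summable α β).mul_left C) fun m => ?_
    rw [norm_mul]
    gcongr
    exact hb _
  have h0 : (0 : ℤ) ∈ hfin.toFinset := by
    rw [Set.Finite.mem_toFinset]
    exact hθ₀
  have := trig_unique α β hαβ hfin.toFinset (fun k => b₁ k - b₂ k) ?_ 0 h0
  · apply hne
    rw [← hb₁0, ← hb₂0]
    exact sub_eq_zero.1 this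
  · intro l
    have h1 : ∑' m : ℤ, (b₁ (m - l) - b₂ (m - l)) * Phi α β m = 0 := by
      simp only [sub_mul]
      rw [(hsum b₁ (hnorm n₁ b₁ hb₁) l).tsum_sub (hsum b₂ (hnorm n₂ b₂ hb₂) l), hz₁, hz₂, sub_zero]
    rw [← (Equiv.addRight l).tsum_eq] at h1
    simp only [Equiv.coe_addRight, add_sub_cancel_right] at h1
    rw [tsum_eq_sum (s := hfin.toFinset)] at h1
    · exact h1
    · intro k hk
      rw [Set.Finite.mem_toFinset] at hk
      rw [hb₁k k hk, hb₂k k hk, sub_self, zero_mul]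
end
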